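/- Fix an integer n ≥ 4. For every nonnegative integer j with j ≡ 3n−9 (mod 2) and 0 ≤ j ≤ 3(n−3), set μ_1 = (3n+j−9)/2, μ_2 = (3n−j−9)/2, μ_3 = 0, m = min{μ_1−μ_2, μ_2−μ_3} = min{j, μ_2}, and ε = 1 if (m ≡ 0 mod 2 and μ_2 ≡ 0 mod 2) or m ≡ 3 or 5 (mod 6), and ε = 0 otherwise. Then the multiplicity of F_j in ∧^3 ℂ^n regarded as a representation of the principal sl_2-subalgebra of sl_n(ℂ) (i.e., dim V_j − dim V_{j+2} for the eigenspaces of H_n on ∧^3 ℂ^n) equals ⌊m/6⌋ + ε. -/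

import Mathlib

/-- Index set for the standard basis of `⋀^k ℂ^n`: a subset `S` of size `k`
encodes the wedge `e_{i_1} ∧ ⋯ ∧ e_{i_k}` over the elements of `S` in increasing order. -/
abbrev WedgeIdx (n k : ℕ) := {S : Finset (Fin n) // S.card = k}

/-- Model of the exterior power `⋀^k ℂ^n`, presented via its standard basis of
wedges of standard basis vectors. -/
abbrev Wedge (n k : ℕ) := WedgeIdx n k →₀ ℂ

/-- The action on `⋀^k ℂ^n` (as a derivation) of the diagonal matrix with diagonal
entries `h`: the basis wedge indexed by `S` is an eigenvector of eigenvalue `∑ i ∈ S, h i`. -/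
noncomputable def wedgeH (n k : ℕ) (h : Fin n → ℤ) : Module.End ℂ (Wedge n k) :=
  (Finsupp.basisSingleOne (R := ℂ)).constr ℂ fun S =>
    ((∑ i ∈ S.1, h i : ℤ) : ℂ) • Finsupp.single S 1

/-- `dim V_j`: the dimension of the eigenvalue-`j` eigenspace of the diagonal action. -/
noncomputable def eigdim (n k : ℕ) (h : Fin n → ℤ) (j : ℤ) : ℕ :=
  Module.finrank ℂ ↥(Module.End.eigenspace (wedgeH n k h) (j : ℂ))

/-- The multiplicity of the irreducible `sl₂`-representation `F_j` in `⋀^k ℂ^n`: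
`dim V_j - dim V_{j+2}`. -/
noncomputable def multF (n k : ℕ) (h : Fin n → ℤ) (j : ℤ) : ℤ :=
  (eigdim n k h j : ℤ) - eigdim n k h (j + 2)

/-- The diagonal of `H_n = diag (n-1, n-3, …, -(n-1))`, the semisimple element of the
principal `sl₂`-triple of `sl_n(ℂ)` (0-indexed: entry `i` is `n - 1 - 2i`). -/
def hPrin (n : ℕ) : Fin n → ℤ := fun i => (n : ℤ) - 1 - 2 * (i : ℕ)

/-- The diagonal operator `wedgeH` acts coordinatewise. -/
theorem wedgeH_apply (n k : ℕ) (h : Fin n → ℤ) (v : Wedge n k) (S : WedgeIdx n k) :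
    wedgeH n k h v S = ((∑ i ∈ S.1, h i : ℤ) : ℂ) * v S := by
  induction v using Finsupp.induction_linear with
  | zero => simp
  | add f g hf hg => rw [map_add, Finsupp.add_apply, hf, hg, Finsupp.add_apply, mul_add]
  | single T a =>
    have hT : wedgeH n k h (Finsupp.single T 1) =
        ((∑ i ∈ T.1, h i : ℤ) : ℂ) • Finsupp.single T 1 := by
      have := (Finsupp.basisSingleOne (R := ℂ) (ι := WedgeIdx n k)).constr_basis ℂ
        (fun S => ((∑ i ∈ S.1, h i : ℤ) : ℂ) • Finsupp.single S (1 : ℂ)) T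
      rwa [Finsupp.coe_basisSingleOne] at this
    have ha : (Finsupp.single T a : Wedge n k) = a • Finsupp.single T 1 := by simp
    rw [ha, map_smul, hT]
    by_cases hTS : T = S
    · subst hTS; simp [mul_comm]
    · simp [Finsupp.single_eq_of_ne' hTS]

theorem eigenspace_wedgeH (n k : ℕ) (h : Fin n → ℤ) (j : ℤ) :
    Module.End.eigenspace (wedgeH n k h) (j : ℂ) =
      Finsupp.supported ℂ ℂ {S : WedgeIdx n k | ∑ i ∈ S.1, h i = j} := by
  ext v
  rw [Module.End.mem_eigenspace_iff, Finsupp.mem_supported', Finsupp.ext_iff]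
  refine forall_congr' fun S => ?_
  rw [wedgeH_apply, Finsupp.smul_apply, smul_eq_mul, mul_eq_mul_right_iff, Int.cast_inj,
    Set.mem_ofPred_eq, or_iff_not_imp_left]

theorem eigdim_eq_card (n k : ℕ) (h : Fin n → ℤ) (j : ℤ) :
    eigdim n k h j =
      ((Finset.univ.powersetCard k).filter fun S : Finset (Fin n) => ∑ i ∈ S, h i = j).card := by
  classical
  rw [eigdim, eigenspace_wedgeH, (Finsupp.supportedEquivFinsupp _).finrank_eq,
    Module.finrank_finsupp_self, Fintype.card_subtype]
  refine Finset.card_bij (fun S _ => S.1) ?_ ?_ ?_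
  · intro S hS
    simpa [S.2] using hS
  · intro S _ T _ hST
    exact Subtype.ext hST
  · intro S hS
    simp only [Finset.mem_filter, Finset.mem_powersetCard_univ] at hS
    exact ⟨⟨S, hS.1⟩, by simpa using hS.2, rfl⟩

/-- The number of `k`-element subsets of `{0, …, n - 1}` with sum `s`. -/
def subsetSumCount (n k : ℕ) (s : ℤ) : ℕ :=
  (((Finset.range n).powersetCard k).filter fun S : Finset ℕ => ∑ i ∈ S, (i : ℤ) = s).card

theorem eigdim_hPrin (n k : ℕ) (j s : ℤ) (hs : k * ((n : ℤ) - 1) - 2 * s = j) :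
    eigdim n k (hPrin n) j = subsetSumCount n k s := by
  have hr : Finset.range n = (Finset.univ : Finset (Fin n)).map Fin.valEmbedding := by
    ext i
    simp only [Finset.mem_range, Finset.mem_map, Finset.mem_univ, true_and]
    exact ⟨fun hi => ⟨⟨i, hi⟩, rfl⟩, by rintro ⟨x, rfl⟩; exact x.2⟩
  rw [eigdim_eq_card, subsetSumCount, hr, Finset.powersetCard_map, Finset.filter_map,
    Finset.card_map]
  congr 1
  refine Finset.filter_congr fun S hS => ?_
  rw [Finset.mem_powersetCard_univ] at hS
  have hsum : ∑ i ∈ S, hPrin n i = k * ((n : ℤ) - 1) - 2 * ∑ i ∈ S, ((i : ℕ) : ℤ) := by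
    simp only [hPrin, Finset.sum_sub_distrib, ← Finset.mul_sum, Finset.sum_const, hS, nsmul_eq_mul]
    ring
  simp only [Function.comp, Finset.mapEmbedding_apply, RelEmbedding.coe_toEmbedding,
    Finset.sum_map, Fin.valEmbedding_apply]
  rw [hsum]
  omega

theorem subsetSumCount_zero_right (n : ℕ) (s : ℤ) :
    subsetSumCount n 0 s = if s = 0 then 1 else 0 := by
  by_cases hs : s = 0 <;> simp [subsetSumCount, Finset.filter_singleton, eq_comm, hs]

theorem subsetSumCount_zero_succ (k : ℕ) (s : ℤ) : subsetSumCount 0 (k + 1) s = 0 := by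
  simp [subsetSumCount]

theorem subsetSumCount_succ_succ (n k : ℕ) (s : ℤ) :
    subsetSumCount (n + 1) (k + 1) s =
      subsetSumCount n (k + 1) s + subsetSumCount n k (s - n) := by
  have hmem : ∀ S ∈ (Finset.range n).powersetCard k, n ∉ S := fun S hS hn =>
    Finset.notMem_range_self ((Finset.mem_powersetCard.1 hS).1 hn)
  rw [subsetSumCount, Finset.range_add_one,
    Finset.powersetCard_succ_insert Finset.notMem_range_self, Finset.filter_union,
    Finset.card_union_of_disjoint]
  · rw [← subsetSumCount, Finset.filter_image, Finset.card_image_of_injOn]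
    · rw [subsetSumCount, subsetSumCount]
      congr 2
      refine Finset.filter_congr fun S hS => ?_
      rw [Finset.sum_insert (hmem S hS)]
      omega
    · intro S hS T hT hST
      have hS' := hmem S (Finset.mem_filter.1 hS).1
      have hT' := hmem T (Finset.mem_filter.1 hT).1
      rw [← Finset.erase_insert hS', ← Finset.erase_insert hT']
      exact congrArg (Finset.erase · n) hST
  · refine Finset.disjoint_filter_filter (Finset.disjoint_left.2 fun S hS hS' => ?_)
    obtain ⟨T, -, rfl⟩ := Finset.mem_image.1 hS'
    exact Finset.notMem_range_self
      ((Finset.mem_powersetCard.1 hS).1 (Finset.mem_insert_self n T))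

/-- The first difference of `subsetSumCount` in the sum. -/
def subsetSumDiff (n k : ℕ) (s : ℤ) : ℤ :=
  (subsetSumCount n k s : ℤ) - subsetSumCount n k (s - 1)

theorem subsetSumDiff_zero_succ (k : ℕ) (s : ℤ) : subsetSumDiff 0 (k + 1) s = 0 := by
  simp [subsetSumDiff, subsetSumCount_zero_succ]

theorem subsetSumDiff_succ_succ (n k : ℕ) (s : ℤ) :
    subsetSumDiff (n + 1) (k + 1) s = subsetSumDiff n (k + 1) s + subsetSumDiff n k (s - n) := by
  simp only [subsetSumDiff, subsetSumCount_succ_succ, sub_right_comm s (n : ℤ) 1]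
  push_cast
  ring

/-- The number of ways to write `x` as a sum of copies of `2`. -/
def twoPartitions (x : ℤ) : ℤ := if 0 ≤ x ∧ x % 2 = 0 then 1 else 0

/-- The number of ways to write `x` as a sum of copies of `2` and `3`. -/
def twoThreePartitions (x : ℤ) : ℤ :=
  if 0 ≤ x then x / 6 + (if x % 6 = 1 then 0 else 1) else 0

theorem twoPartitions_sub (x : ℤ) :
    twoPartitions x - twoPartitions (x - 2) = if x = 0 then 1 else 0 := by
  unfold twoPartitions
  split_ifs <;> omega

theorem twoThreePartitions_sub (x : ℤ) :
    twoThreePartitions x - twoThreePartitions (x - 3) = twoPartitions x := by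
  unfold twoThreePartitions twoPartitions
  split_ifs <;> omega

theorem subsetSumDiff_one (n : ℕ) (s : ℤ) :
    subsetSumDiff n 1 s = (if s = 0 then 1 else 0) - (if s - n = 0 then 1 else 0) := by
  induction n with
  | zero => simp [subsetSumDiff_zero_succ 0]
  | succ n ih =>
    rw [subsetSumDiff_succ_succ, ih, subsetSumDiff, subsetSumCount_zero_right,
      subsetSumCount_zero_right]
    push_cast
    split_ifs <;> omega

theorem subsetSumDiff_two (n : ℕ) (s : ℤ) :
    subsetSumDiff n 2 s = twoPartitions (s - 1) - twoPartitions (s - n)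
      - twoPartitions (s - n - 1) + twoPartitions (s - 2 * n) := by
  induction n with
  | zero => simp [subsetSumDiff_zero_succ 1]
  | succ n ih =>
    rw [subsetSumDiff_succ_succ, ih, subsetSumDiff_one, ← twoPartitions_sub, ← twoPartitions_sub]
    push_cast
    ring_nf

theorem subsetSumDiff_three (n : ℕ) (s : ℤ) :
    subsetSumDiff n 3 s = twoThreePartitions (s - 3) - twoThreePartitions (s - n - 1)
      - twoThreePartitions (s - n - 2) - twoThreePartitions (s - n - 3)
      + twoThreePartitions (s - 2 * n) + twoThreePartitions (s - 2 * n - 1)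
      + twoThreePartitions (s - 2 * n - 2) - twoThreePartitions (s - 3 * n) := by
  induction n with
  | zero =>
    simp [subsetSumDiff_zero_succ 2]
    ring
  | succ n ih =>
    rw [subsetSumDiff_succ_succ, ih, subsetSumDiff_two]
    simp only [← twoThreePartitions_sub]
    push_cast
    ring_nf

theorem twoThreePartitions_of_neg {x : ℤ} (hx : x < 0) : twoThreePartitions x = 0 :=
  if_neg (not_le.2 hx)

theorem twoThreePartitions_add_add {x : ℤ} (hx : 0 ≤ x) :
    twoThreePartitions x + twoThreePartitions (x - 1) + twoThreePartitions (x - 2) =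
      x / 2 + 1 := by
  unfold twoThreePartitions
  split_ifs <;> omega

/-- for `n ≥ 4` and `0 ≤ j ≤ 3(n-3)` with `j ≡ 3n - 9 (mod 2)`, setting
`μ₂ = (3n - j - 9)/2`, `m = min {j, μ₂}` and `ε` as below, the multiplicity of `F_j` in
`⋀³ ℂ^n` under the principal `sl₂`-subalgebra of `sl_n(ℂ)` equals `⌊m/6⌋ + ε`. -/
theorem stmt9 (n : ℕ) (hn : 4 ≤ n) (j : ℕ)
    (hpar : (3 * (n : ℤ) - 9 - j) % 2 = 0)
    (hj : (j : ℤ) ≤ 3 * ((n : ℤ) - 3)) :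
    ∀ μ₂ m : ℤ, μ₂ = (3 * (n : ℤ) - j - 9) / 2 → m = min (j : ℤ) μ₂ →
      multF n 3 (hPrin n) j =
        m / 6 + (if (m % 2 = 0 ∧ μ₂ % 2 = 0) ∨ m % 6 = 3 ∨ m % 6 = 5 then 1 else 0) := by
  intro p m hp hm
  have hnp : (j : ℤ) = 3 * n - 9 - 2 * p := by omega
  have hmult : multF n 3 (hPrin n) j = subsetSumDiff n 3 (p + 3) := by
    rw [multF, subsetSumDiff, eigdim_hPrin n 3 j (p + 3) (by push_cast; omega),
      eigdim_hPrin n 3 (j + 2) (p + 3 - 1) (by push_cast; omega)]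
  rw [hmult, subsetSumDiff_three, twoThreePartitions_of_neg (x := p + 3 - 2 * n) (by omega),
    twoThreePartitions_of_neg (x := p + 3 - 2 * n - 1) (by omega),
    twoThreePartitions_of_neg (x := p + 3 - 2 * n - 2) (by omega),
    twoThreePartitions_of_neg (x := p + 3 - 3 * n) (by omega)]
  have hp0 : 0 ≤ p := by omega
  rcases le_or_gt p j with h | h
  · obtain rfl : m = p := by omega
    rw [twoThreePartitions_of_neg (x := m + 3 - n - 1) (by omega),
      twoThreePartitions_of_neg (x := m + 3 - n - 2) (by omega),
      twoThreePartitions_of_neg (x := m + 3 - n - 3) (by omega)]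
    unfold twoThreePartitions
    split_ifs <;> omega
  · obtain rfl : m = j := by omega
    obtain ⟨q, hq⟩ : ∃ q : ℤ, q = p + 3 - n - 1 := ⟨_, rfl⟩
    rw [← hq, show p + 3 - n - 2 = q - 1 by omega, show p + 3 - n - 3 = q - 2 by omega, sub_sub,
      sub_sub, ← add_assoc, twoThreePartitions_add_add (by omega)]
    obtain rfl : p = j + 3 * q + 3 := by omega
    unfold twoThreePartitions
    split_ifs <;> omega
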